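/- Let p ≥ 5 be a prime and n ≥ 2. Then E(n) is (p^{n−1} − p + 3)-trivial in W(n): for every elementary abelian p-subgroup A of the iterated wreath product W(n) with rank at least p^{n−1} − p + 3, the centralizer of A in W(n) is contained in E(n). -/

import Mathlib

/-- The shift automorphism of the direct power `ZMod p → H` by `k : ZMod p`. -/
def shiftAut (p : ℕ) (H : Type*) [Group H] (k : ZMod p) : MulAut (ZMod p → H) where
  toFun f := fun i => f (i + k)
  invFun f := fun i => f (i - k)
  left_inv f := by funext i; simp
  right_inv f := by funext i; simp
  map_mul' f g := rfl

/-- The shift action of `ZMod p` on the direct power `ZMod p → H`. -/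
def shiftHom (p : ℕ) (H : Type*) [Group H] :
    Multiplicative (ZMod p) →* MulAut (ZMod p → H) where
  toFun k := shiftAut p H k.toAdd
  map_one' := by
    ext f i
    show f (i + Multiplicative.toAdd 1) = f i
    simp
  map_mul' a b := by
    ext f i
    show f (i + Multiplicative.toAdd (a * b)) = f (i + Multiplicative.toAdd a + Multiplicative.toAdd b)
    rw [toAdd_mul, add_assoc]

/-- The wreath product `H ≀ ℤ/p`. -/
abbrev WreathZp (p : ℕ) (H : Type*) [Group H] : Type _ :=
  SemidirectProduct (ZMod p → H) (Multiplicative (ZMod p)) (shiftHom p H)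

/-- The inclusion of the base subgroup `H^p` into the wreath product. -/
abbrev wreathInl (p : ℕ) (H : Type*) [Group H] : (ZMod p → H) →* WreathZp p H :=
  SemidirectProduct.inl

/-- The base subgroup `H^p` of the wreath product, i.e. the elements with trivial
`ZMod p` component. -/
def wreathBase (p : ℕ) (H : Type*) [Group H] : Subgroup (WreathZp p H) :=
  (wreathInl p H).range

/-- `E` is an elementary abelian `p`-subgroup (a `p`-torus) of rank `r`, i.e. `E` is
isomorphic to `(ZMod p)^r`. -/
def IsPTorus (p : ℕ) {G : Type*} [Group G] (E : Subgroup G) (r : ℕ) : Prop :=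
  Nonempty (E ≃* (Fin r → Multiplicative (ZMod p)))

/-- The `p`-rank of a group: the maximal rank of an elementary abelian `p`-subgroup. -/
noncomputable def pRank (p : ℕ) (G : Type*) [Group G] : ℕ :=
  sSup {r | ∃ E : Subgroup G, IsPTorus p E r}


/-- A subgroup `H` of `G` is `i`-trivial if the centralizer of every elementary abelian
`p`-subgroup of rank at least `i` is contained in `H`. -/
def ITrivial (p : ℕ) {G : Type*} [Group G] (H : Subgroup G) (i : ℕ) : Prop :=
  ∀ (E : Subgroup G) (r : ℕ), i ≤ r → IsPTorus p E r →
    Subgroup.centralizer (E : Set G) ≤ H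

/-- For a subgroup `K ≤ H`, the subgroup `K^p = (ZMod p → K)` of the base subgroup of
the wreath product `H ≀ ℤ/p`. -/
def wreathBasePow (p : ℕ) {H : Type*} [Group H] (K : Subgroup H) :
    Subgroup (WreathZp p H) :=
  (Subgroup.pi (Set.univ : Set (ZMod p)) fun _ => K).map (wreathInl p H)

/-- Auxiliary bundled construction of the iterated wreath products. -/
def WAux (p : ℕ) : ℕ → Σ G : Type, Group G
  | 0 => ⟨Multiplicative (ZMod p), inferInstance⟩
  | 1 => ⟨Multiplicative (ZMod p), inferInstance⟩
  | (n + 2) =>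
      letI := (WAux p (n + 1)).2
      ⟨WreathZp p (WAux p (n + 1)).1, inferInstance⟩

/-- The iterated wreath product `W(n)`: `W(1) = ℤ/p` and `W(n) = W(n-1) ≀ ℤ/p`,
a Sylow `p`-subgroup of the symmetric group on `p^n` letters. -/
def W (p n : ℕ) : Type := (WAux p n).1

instance instGroupW (p n : ℕ) : Group (W p n) := (WAux p n).2

/-- The subgroup `E(n) ≤ W(n)`: `E(1) = W(1)` and `E(n) = E(n-1)^p`, the subgroup
`(ZMod p → E(n-1))` of the base subgroup of `W(n) = W(n-1) ≀ ℤ/p`. -/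
def EW (p : ℕ) : (n : ℕ) → Subgroup (W p n)
  | 0 => ⊤
  | 1 => ⊤
  | (n + 2) => wreathBasePow (H := W p (n + 1)) p (EW p (n + 1))

/-- Elementary abelian, elementwise. -/
def EAb (p : ℕ) {G : Type*} [Group G] (A : Subgroup G) : Prop :=
  (∀ a ∈ A, ∀ b ∈ A, a * b = b * a) ∧ ∀ a ∈ A, a ^ p = 1

lemma EAb.map {p : ℕ} {G K : Type*} [Group G] [Group K] {A : Subgroup G} (h : EAb p A)
    (f : G →* K) : EAb p (A.map f) := by
  refine ⟨?_, ?_⟩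
  · rintro _ ⟨a, ha, rfl⟩ _ ⟨b, hb, rfl⟩
    rw [← map_mul, ← map_mul, h.1 a ha b hb]
  · rintro _ ⟨a, ha, rfl⟩
    rw [← map_pow, h.2 a ha, map_one]

lemma EAb.comap {p : ℕ} {G K : Type*} [Group G] [Group K] {A : Subgroup G} (h : EAb p A)
    (f : K →* G) (hf : Function.Injective f) : EAb p (A.comap f) := by
  refine ⟨?_, ?_⟩
  · intro a ha b hb
    apply hf
    rw [map_mul, map_mul, h.1 _ ha _ hb]
  · intro a ha
    apply hf
    rw [map_pow, h.2 _ ha, map_one]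

lemma inl_comm {p : ℕ} {H : Type*} [Group H] (b : ZMod p → H) (w : WreathZp p H)
    (h : wreathInl p H b * w = w * wreathInl p H b) (i : ZMod p) :
    b i * w.left i = w.left i * b (i + Multiplicative.toAdd w.right) := by
  have h2 := congrArg (fun x : WreathZp p H => x.left i) h
  simpa [SemidirectProduct.mul_left, shiftHom, shiftAut] using h2

lemma card_le_of_moved {p : ℕ} [Fact p.Prime] {H : Type*} [Group H] [Finite H] (M : ℕ)
    (hM : ∀ B : Subgroup H, EAb p B → Nat.card B ≤ M)
    (A : Subgroup (WreathZp p H)) (hA : EAb p A) (w : WreathZp p H)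
    (hw : ∀ a ∈ A, a * w = w * a) (hw1 : w.right ≠ 1) : Nat.card A ≤ M * p := by
  set B : Subgroup (ZMod p → H) := A.comap (wreathInl p H) with hB
  have hBE : EAb p B := hA.comap _ SemidirectProduct.inl_injective
  have hk : Multiplicative.toAdd w.right ≠ 0 := fun h => hw1 (toAdd_eq_zero.mp h)
  have hinj : Function.Injective ((Pi.evalMonoidHom (fun _ : ZMod p => H) 0).comp B.subtype) := by
    rw [injective_iff_map_eq_one]
    rintro ⟨b, hb⟩ hb0
    have hb0 : b 0 = 1 := hb0
    have key : ∀ j : ℕ, b ((j : ZMod p) * Multiplicative.toAdd w.right) = 1 := by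
      intro j
      induction j with
      | zero => simpa using hb0
      | succ j ih =>
        have := inl_comm b w (hw _ hb) ((j : ZMod p) * Multiplicative.toAdd w.right)
        rw [ih, one_mul] at this
        have h3 := (mul_eq_left.mp this.symm)
        push_cast
        rw [add_mul, one_mul]
        exact h3
    apply Subtype.ext
    funext i
    have := key (i / Multiplicative.toAdd w.right).val
    rw [ZMod.natCast_zmod_val, div_mul_cancel₀ _ hk] at this
    exact this
  have hBM : Nat.card B ≤ M := by
    refine le_trans ?_ (hM _ (hBE.map (Pi.evalMonoidHom (fun _ : ZMod p => H) 0)))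
    refine Nat.card_le_card_of_injective
      (fun b : B => (⟨_, Subgroup.mem_map_of_mem _ b.2⟩ :
        B.map (Pi.evalMonoidHom (fun _ : ZMod p => H) 0))) ?_
    intro a b hab
    exact hinj (congrArg Subtype.val hab)
  let f : A →* Multiplicative (ZMod p) := (SemidirectProduct.rightHom).comp A.subtype
  have h1 : Nat.card A = Nat.card f.ker * Nat.card f.range := by
    rw [← Subgroup.index_ker, Subgroup.card_mul_index]
  have h2 : Nat.card f.range ≤ p := by
    refine (Subgroup.card_le_card_group _).trans ?_
    simp [Nat.card_congr Multiplicative.toAdd]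
  have h3 : Nat.card f.ker ≤ Nat.card B := by
    have hk : ∀ x : f.ker, wreathInl p H x.1.1.left = x.1.1 := by
      intro x
      have hx : x.1.1.right = 1 := x.2
      ext1
      · simp
      · simp [hx]
    refine Nat.card_le_card_of_injective
      (fun x : f.ker => (⟨x.1.1.left, by
        rw [hB, Subgroup.mem_comap, hk]; exact x.1.2⟩ : B)) ?_
    intro x y hxy
    have : x.1.1.left = y.1.1.left := congrArg Subtype.val hxy
    apply Subtype.ext
    apply Subtype.ext
    rw [← hk x, ← hk y, this]
  rw [h1]
  exact Nat.mul_le_mul (h3.trans hBM) h2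

lemma card_le_prod {p : ℕ} [Fact p.Prime] {H : Type*} [Group H] [Finite H]
    (A : Subgroup (WreathZp p H)) (hA : ∀ a ∈ A, a.right = 1) :
    Nat.card A ≤ ∏ i : ZMod p, Nat.card ((A.comap (wreathInl p H)).map
      (Pi.evalMonoidHom (fun _ : ZMod p => H) i)) := by
  rw [← Nat.card_pi]
  have hk : ∀ x : A, wreathInl p H x.1.left = x.1 := by
    intro x
    have hx : x.1.right = 1 := hA _ x.2
    ext1
    · simp
    · simp [hx]
  refine Nat.card_le_card_of_injective
    (fun x : A => fun i => (⟨x.1.left i, x.1.left, by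
      show wreathInl p H x.1.left ∈ A
      rw [hk]; exact x.2, rfl⟩ : ((A.comap (wreathInl p H)).map
      (Pi.evalMonoidHom (fun _ : ZMod p => H) i)))) ?_
  intro x y hxy
  have : x.1.left = y.1.left := by
    funext i
    exact congrArg Subtype.val (congrFun hxy i)
  apply Subtype.ext
  rw [← hk x, ← hk y, this]

lemma wreath_finite {p : ℕ} [Fact p.Prime] {H : Type*} [Group H] [Finite H] :
    Finite (WreathZp p H) :=
  Finite.of_equiv _ SemidirectProduct.equivProd.symm

lemma W_finite (p : ℕ) [Fact p.Prime] (n : ℕ) : Finite (W p (n + 1)) := by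
  induction n with
  | zero => exact inferInstanceAs (Finite (Multiplicative (ZMod p)))
  | succ n ih => exact wreath_finite (H := W p (n + 1))

lemma rank_bound_step {p : ℕ} [Fact p.Prime] {H : Type*} [Group H] [Finite H] (m : ℕ)
    (hm : 1 ≤ m)
    (hM : ∀ B : Subgroup H, EAb p B → Nat.card B ≤ p ^ m)
    (A : Subgroup (WreathZp p H)) (hA : EAb p A) : Nat.card A ≤ p ^ (m * p) := by
  have hp : p.Prime := Fact.out
  by_cases h : ∀ a ∈ A, a.right = 1
  · refine (card_le_prod A h).trans ?_
    refine (Finset.prod_le_pow_card _ _ (p ^ m) ?_).trans ?_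
    · intro i _
      exact hM _ ((hA.comap _ SemidirectProduct.inl_injective).map _)
    · simp [ZMod.card, pow_mul]
  · push Not at h
    obtain ⟨w, hwA, hw⟩ := h
    refine (card_le_of_moved _ hM A hA w (fun a ha => hA.1 a ha w hwA) hw).trans ?_
    rw [← pow_succ]
    apply Nat.pow_le_pow_right hp.pos
    have := hp.two_le
    nlinarith

lemma W_rank (p : ℕ) [Fact p.Prime] (n : ℕ) :
    ∀ A : Subgroup (W p (n + 1)), EAb p A → Nat.card A ≤ p ^ (p ^ n) := by
  have hp : p.Prime := Fact.out
  induction n with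
  | zero =>
    intro A _
    haveI := W_finite p 0
    refine (Subgroup.card_le_card_group _).trans ?_
    have : Nat.card (W p (0 + 1)) = Nat.card (Multiplicative (ZMod p)) := rfl
    rw [this]
    simp [Nat.card_congr Multiplicative.toAdd]
  | succ n ih =>
    intro A hA
    haveI := W_finite p n
    have := rank_bound_step (H := W p (n + 1)) (p ^ n) (Nat.one_le_pow _ _ hp.pos) ih A hA
    rwa [← pow_succ] at this

lemma main_step {p : ℕ} [Fact p.Prime] {H : Type*} [Group H] [Finite H] (m c : ℕ) (E : Subgroup H)
    (hM : ∀ B : Subgroup H, EAb p B → Nat.card B ≤ p ^ m)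
    (hc : ∀ B : Subgroup H, EAb p B → ∀ w, (∀ a ∈ B, a * w = w * a) → w ∉ E →
      Nat.card B ≤ p ^ c ∧ m * (p - 1) + c + p ≤ m * p + 2)
    (hmp : m + 1 + p ≤ m * p + 2)
    (A : Subgroup (WreathZp p H)) (hA : EAb p A) (w : WreathZp p H)
    (hw : ∀ a ∈ A, a * w = w * a) (hwE : w ∉ wreathBasePow p E) :
    Nat.card A ≤ p ^ (m * p - p + 2) := by
  have hp : p.Prime := Fact.out
  have moved : ∀ w : WreathZp p H, (∀ a ∈ A, a * w = w * a) → w.right ≠ 1 →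
      Nat.card A ≤ p ^ (m * p - p + 2) := by
    intro w hw hw1
    refine (card_le_of_moved _ hM A hA w hw hw1).trans ?_
    rw [← pow_succ]
    apply Nat.pow_le_pow_right hp.pos
    omega
  by_cases hw1 : w.right ≠ 1
  · exact moved w hw hw1
  push Not at hw1
  by_cases h : ∀ a ∈ A, a.right = 1
  swap
  · push Not at h
    obtain ⟨v, hvA, hv⟩ := h
    exact moved v (fun a ha => hA.1 a ha v hvA) hv
  have hex : ∃ i, w.left i ∉ E := by
    by_contra hcon
    push Not at hcon
    apply hwE
    refine ⟨w.left, fun i _ => hcon i, ?_⟩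
    ext1
    · simp
    · simp [hw1]
  obtain ⟨i, hi⟩ := hex
  have hEB : ∀ j, EAb p ((A.comap (wreathInl p H)).map
      (Pi.evalMonoidHom (fun _ : ZMod p => H) j)) :=
    fun j => (hA.comap _ SemidirectProduct.inl_injective).map _
  obtain ⟨h1, h2⟩ := hc _ (hEB i) (w.left i) (by
    rintro _ ⟨b, hb, rfl⟩
    have := inl_comm b w (hw _ hb) i
    rw [hw1] at this
    simpa using this) hi
  refine (card_le_prod A h).trans ?_
  rw [← Finset.mul_prod_erase _ _ (Finset.mem_univ i)]
  refine (Nat.mul_le_mul h1 (Finset.prod_le_pow_card _ _ (p ^ m)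
    (fun j _ => hM _ (hEB j)))).trans ?_
  rw [Finset.card_erase_of_mem (Finset.mem_univ i), Finset.card_univ, ZMod.card, ← pow_mul,
    ← pow_add]
  apply Nat.pow_le_pow_right hp.pos
  omega

lemma W_main (p : ℕ) [Fact p.Prime] (n : ℕ) :
    ∀ A : Subgroup (W p (n + 1)), EAb p A → ∀ w, (∀ a ∈ A, a * w = w * a) →
      w ∉ EW p (n + 1) → 1 ≤ n ∧ Nat.card A ≤ p ^ (p ^ n - p + 2) := by
  have hp : p.Prime := Fact.out
  induction n with
  | zero =>
    intro A _ w _ hw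
    exact absurd (Subgroup.mem_top w) hw
  | succ n ih =>
    intro A hA w hw hwE
    refine ⟨by omega, ?_⟩
    haveI := W_finite p n
    have h2 := hp.two_le
    have hpn : 1 ≤ p ^ n := Nat.one_le_pow _ _ hp.pos
    have := main_step (H := W p (n + 1)) (p ^ n) (p ^ n - p + 2) (EW p (n + 1)) (W_rank p n)
      (fun B hB v hv hvE => by
        obtain ⟨h3, h4⟩ := ih B hB v hv hvE
        refine ⟨h4, ?_⟩
        have h5 : p ≤ p ^ n := Nat.le_self_pow (by omega) p
        have h6 : p ^ n * (p - 1) + p ^ n = p ^ n * p := by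
          rw [← Nat.mul_succ]; congr 1; omega
        omega)
      (by
        obtain ⟨q, rfl⟩ : ∃ q, p = q + 1 := ⟨p - 1, by omega⟩
        nlinarith)
      A hA w hw hwE
    rwa [← pow_succ] at this

/-- for `p ≥ 5` prime and `n ≥ 2`, `E(n)` is `(p^(n-1) - p + 3)`-trivial in
`W(n)`: the centralizer in `W(n)` of every elementary abelian `p`-subgroup of rank at
least `p^(n-1) - p + 3` is contained in `E(n)`. -/
theorem stmt7 (p n : ℕ) (hp : p.Prime) (hp5 : 5 ≤ p) (hn : 2 ≤ n) :
    ITrivial p (EW p n) (p ^ (n - 1) - p + 3) := by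
  haveI : Fact p.Prime := ⟨hp⟩
  obtain ⟨m, rfl⟩ : ∃ m, n = m + 1 := ⟨n - 1, by omega⟩
  intro A r hr ⟨e⟩ w hw
  by_contra hwE
  have hA : EAb p A := by
    refine ⟨fun a ha b hb => ?_, fun a ha => ?_⟩
    · have : (⟨a, ha⟩ : A) * ⟨b, hb⟩ = ⟨b, hb⟩ * ⟨a, ha⟩ := by
        apply e.injective
        rw [map_mul, map_mul, mul_comm]
      exact congrArg Subtype.val this
    · have : (⟨a, ha⟩ : A) ^ p = 1 := by
        apply e.injective
        rw [map_pow, map_one]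
        funext i
        apply Multiplicative.toAdd.injective
        simp
      exact congrArg Subtype.val this
  obtain ⟨_, h⟩ := W_main p m A hA w
    (fun a ha => Subgroup.mem_centralizer_iff.mp hw a ha) hwE
  rw [Nat.card_congr e.toEquiv, Nat.card_fun, Nat.card_congr Multiplicative.toAdd] at h
  simp only [Nat.card_eq_fintype_card, Fintype.card_fin, ZMod.card] at h
  have := (Nat.pow_le_pow_iff_right hp.one_lt).mp h
  simp only [Nat.add_sub_cancel] at hr
  omega
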